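/- Let m ≥ 2 and n ≥ 1 be integers and let 𝒜, ℬ be symmetric m-th order n-dimensional real tensors with 𝒜 strictly copositive. Then the triplet (𝒜, ℬ, −ℐ) has at least one m-degree Pareto-eigenpair: there exist λ ∈ ℝ and x ∈ ℝ^n \ {0} with x ≥ 0, (λ^m 𝒜 + λ ℬ − ℐ)x^{m-1} ≥ 0 componentwise, and ⟨x, (λ^m 𝒜 + λ ℬ − ℐ)x^{m-1}⟩ = 0. -/

import Mathlib

open Finset

/-- `𝒜x^{m-1}` for an `(k+1)`-th order `n`-dimensional tensor `A`. -/
noncomputable def tApply {n k : ℕ} (A : (Fin (k + 1) → Fin n) → ℝ) (x : Fin n → ℝ) :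
    Fin n → ℝ :=
  fun i => ∑ g : Fin k → Fin n, A (Fin.cons i g) * ∏ j, x (g j)

/-- `𝒜x^m` for an `m`-th order `n`-dimensional tensor `A`. -/
noncomputable def tEval {n m : ℕ} (A : (Fin m → Fin n) → ℝ) (x : Fin n → ℝ) : ℝ :=
  ∑ f : Fin m → Fin n, A f * ∏ j, x (f j)

/-- the tensor `λ^m 𝒜 + λ ℬ + 𝒞` where `m = k + 2`. -/
noncomputable def triple {n k : ℕ} (A B C : (Fin (k + 2) → Fin n) → ℝ) (lam : ℝ) :
    (Fin (k + 2) → Fin n) → ℝ :=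
  fun f => lam ^ (k + 2) * A f + lam * B f + C f

/-- `(λ, x)` is an `m`-degree Pareto-eigenpair of the triplet `(A, B, C)`, `m = k + 2`. -/
noncomputable def IsParetoPair {n k : ℕ} (A B C : (Fin (k + 2) → Fin n) → ℝ)
    (lam : ℝ) (x : Fin n → ℝ) : Prop :=
  x ≠ 0 ∧ (∀ i, 0 ≤ x i) ∧ (∀ i, 0 ≤ tApply (triple A B C lam) x i) ∧
    (∑ i, x i * tApply (triple A B C lam) x i) = 0

/-- the unit tensor `ℐ`: entries `1` if all indices coincide and `0` otherwise. -/
noncomputable def unitT {n k : ℕ} : (Fin (k + 2) → Fin n) → ℝ :=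
  fun f => if ∀ t, f t = f 0 then 1 else 0

/-- a tensor is symmetric if its entries are invariant under permutations of the indices. -/
def IsSymm' {n m : ℕ} (A : (Fin m → Fin n) → ℝ) : Prop :=
  ∀ (σ : Equiv.Perm (Fin m)) (f : Fin m → Fin n), A (f ∘ σ) = A f

/-- the objective `φ₀(u,v) = m(m-1)^{1/m−1} v^⊤ u^{[m-1]} − ℬu^m`, `m = k + 2`. -/
noncomputable def phi0 {n k : ℕ} (B : (Fin (k + 2) → Fin n) → ℝ) (u v : Fin n → ℝ) : ℝ :=
  (k + 2 : ℝ) * ((k + 1 : ℝ) ^ ((1 : ℝ) / (k + 2) - 1)) * (∑ i, v i * u i ^ (k + 1)) -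
    tEval B u

/-- membership in the feasible set `F = {(u,v) ≥ 0 : 𝒜u^m + ∑ v_i^m = 1}`. -/
noncomputable def Feasible {n k : ℕ} (A : (Fin (k + 2) → Fin n) → ℝ) (u v : Fin n → ℝ) :
    Prop :=
  (∀ i, 0 ≤ u i) ∧ (∀ i, 0 ≤ v i) ∧ tEval A u + ∑ i, v i ^ (k + 2) = 1

open Filter Topology

section Tensor

variable {n m k : ℕ}

theorem continuous_tEval (A : (Fin m → Fin n) → ℝ) : Continuous (tEval A) := by
  unfold tEval
  fun_prop

theorem tEval_smul (A : (Fin m → Fin n) → ℝ) (s : ℝ) (x : Fin n → ℝ) :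
    tEval A (s • x) = s ^ m * tEval A x := by
  simp only [tEval, Pi.smul_apply, smul_eq_mul, prod_mul_distrib, prod_const, card_univ,
    Fintype.card_fin, mul_sum]
  exact sum_congr rfl fun f _ => by ring

theorem tEval_triple (A B C : (Fin (k + 2) → Fin n) → ℝ) (lam : ℝ) (x : Fin n → ℝ) :
    tEval (triple A B C lam) x = lam ^ (k + 2) * tEval A x + lam * tEval B x + tEval C x := by
  simp only [tEval, triple, mul_sum, ← sum_add_distrib]
  exact sum_congr rfl fun f _ => by ring

theorem isSymm'_triple {A B C : (Fin (k + 2) → Fin n) → ℝ} (hA : IsSymm' A) (hB : IsSymm' B)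
    (hC : IsSymm' C) (lam : ℝ) : IsSymm' (triple A B C lam) := fun σ f => by
  simp only [triple, hA σ f, hB σ f, hC σ f]

theorem isSymm'_neg_unitT : IsSymm' fun f : Fin (k + 2) → Fin n => -unitT f := fun σ f => by
  have h : (∀ t, f (σ t) = f (σ 0)) ↔ ∀ t, f t = f 0 := by
    refine ⟨fun h t => ?_, fun h t => by rw [h, h (σ 0)]⟩
    have h₁ := h (σ.symm t)
    have h₂ := h (σ.symm 0)
    simp only [Equiv.apply_symm_apply] at h₁ h₂
    rw [h₁, h₂]
  simp only [unitT, Function.comp_apply, h]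

theorem tEval_neg_unitT_nonpos {x : Fin n → ℝ} (hx : ∀ i, 0 ≤ x i) :
    tEval (fun f : Fin (k + 2) → Fin n => -unitT f) x ≤ 0 := by
  refine sum_nonpos fun f _ => mul_nonpos_of_nonpos_of_nonneg ?_ (prod_nonneg fun j _ => hx _)
  beta_reduce
  unfold unitT
  split_ifs <;> norm_num

theorem sum_mul_tApply (A : (Fin (k + 1) → Fin n) → ℝ) (x : Fin n → ℝ) :
    ∑ i, x i * tApply A x i = tEval A x := by
  unfold tEval tApply
  rw [← (Fin.consEquiv fun _ => Fin n).sum_comp, Fintype.sum_prod_type]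
  refine sum_congr rfl fun i _ => ?_
  rw [mul_sum]
  refine sum_congr rfl fun g _ => ?_
  simp [Fin.consEquiv, Fin.prod_univ_succ]
  ring

theorem IsSymm'.insertNth_eq_cons {A : (Fin (k + 1) → Fin n) → ℝ} (hA : IsSymm' A)
    (j : Fin (k + 1)) (i : Fin n) (g : Fin k → Fin n) :
    A (j.insertNth i g) = A (Fin.cons i g) := by
  rw [← hA j.cycleRange.symm]
  exact congrArg A (Fin.insertNth_comp_cycleRange_symm j i g)

theorem hasDerivAt_tEval_add_single {A : (Fin (k + 1) → Fin n) → ℝ} (hA : IsSymm' A)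
    (x : Fin n → ℝ) (i : Fin n) :
    HasDerivAt (fun t : ℝ => tEval A (x + t • Pi.single i 1)) ((k + 1) * tApply A x i) 0 := by
  have hcoord (l : Fin n) : HasDerivAt (fun t : ℝ => (x + t • (Pi.single i 1 : Fin n → ℝ)) l)
      ((Pi.single i 1 : Fin n → ℝ) l) 0 := by
    simpa using ((hasDerivAt_id (0 : ℝ)).mul_const ((Pi.single i 1 : Fin n → ℝ) l)).const_add (x l)
  have hsum : HasDerivAt (fun t : ℝ => tEval A (x + t • Pi.single i 1)) _ 0 :=
    HasDerivAt.fun_sum (u := univ) fun f _ =>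
      (HasDerivAt.fun_finsetProd (u := univ) fun j _ => hcoord (f j)).const_mul (A f)
  convert hsum using 1
  simp only [zero_smul, add_zero, mul_sum, smul_eq_mul]
  rw [sum_comm]
  have hterm (j : Fin (k + 1)) : ∑ f : Fin (k + 1) → Fin n, A f *
      ((∏ l ∈ univ.erase j, x (f l)) * (Pi.single i 1 : Fin n → ℝ) (f j)) = tApply A x i := by
    rw [← (Fin.insertNthEquiv (fun _ => Fin n) j).sum_comp, Fintype.sum_prod_type]
    rw [sum_eq_single i]
    · refine sum_congr rfl fun g _ => ?_
      have herase : univ.erase j = univ.image j.succAbove := by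
        rw [Fin.image_succAbove_univ]; ext; simp
      rw [herase, prod_image fun _ _ _ _ h => Fin.succAbove_right_injective h]
      simp [Fin.insertNthEquiv, hA.insertNth_eq_cons]
    · intro l _ hl
      simp [Fin.insertNthEquiv, hl]
    · simp
  simp [hterm]

theorem tApply_nonneg_of_tEval_nonneg {A : (Fin (k + 1) → Fin n) → ℝ} (hA : IsSymm' A)
    (hnonneg : ∀ y : Fin n → ℝ, (∀ i, 0 ≤ y i) → 0 ≤ tEval A y) {x : Fin n → ℝ}
    (hx : ∀ i, 0 ≤ x i) (hx0 : tEval A x = 0) (i : Fin n) : 0 ≤ tApply A x i := by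
  have hslope := (hasDerivWithinAt_iff_tendsto_slope' (s := Set.Ioi (0 : ℝ)) (by simp)).1
    (hasDerivAt_tEval_add_single hA x i).hasDerivWithinAt
  have h : 0 ≤ (k + 1 : ℝ) * tApply A x i := by
    refine ge_of_tendsto hslope ?_
    filter_upwards [self_mem_nhdsWithin] with t ht
    have ht : 0 < t := ht
    have hpos : 0 ≤ tEval A (x + t • Pi.single i 1) := by
      refine hnonneg _ fun l => ?_
      have : 0 ≤ (Pi.single i 1 : Fin n → ℝ) l := by
        by_cases h : l = i
        · subst h; simp
        · simp [h]
      simp only [Pi.add_apply, Pi.smul_apply, smul_eq_mul]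
      have := hx l
      positivity
    simp only [slope_def_field, zero_smul, add_zero, hx0, sub_zero]
    positivity
  exact nonneg_of_mul_nonneg_right h (by positivity)

theorem tEval_nonneg_of_forall_stdSimplex {A : (Fin (k + 1) → Fin n) → ℝ}
    (h : ∀ y ∈ stdSimplex ℝ (Fin n), 0 ≤ tEval A y) {y : Fin n → ℝ} (hy : ∀ i, 0 ≤ y i) :
    0 ≤ tEval A y := by
  rcases (sum_nonneg fun i _ => hy i : 0 ≤ ∑ i, y i).eq_or_lt with hs | hs
  · have hy0 : y = 0 := by
      ext i
      exact (sum_eq_zero_iff_of_nonneg fun i _ => hy i).1 hs.symm i (mem_univ i)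
    simp [hy0, tEval]
  · have hmem : (∑ i, y i)⁻¹ • y ∈ stdSimplex ℝ (Fin n) := by
      refine ⟨fun i => ?_, ?_⟩
      · have := hy i
        simp only [Pi.smul_apply, smul_eq_mul]
        positivity
      · simp only [Pi.smul_apply, smul_eq_mul, ← mul_sum]
        exact inv_mul_cancel₀ hs.ne'
    have heq : y = (∑ i, y i) • (∑ i, y i)⁻¹ • y := by
      rw [smul_smul, mul_inv_cancel₀ hs.ne', one_smul]
    rw [heq, tEval_smul]
    exact mul_nonneg (by positivity) (h _ hmem)

end Tensor

/-- If `a` is positive on a compact set `K`, then `s ^ (k + 2) * a + s * b + c` is positive on `K`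
for some `s ≥ 0`. -/
theorem exists_forall_pow_mul_add_pos {X : Type*} [TopologicalSpace X] {K : Set X}
    (hK : IsCompact K) (hne : K.Nonempty) {a b c : X → ℝ} (ha : Continuous a) (hb : Continuous b)
    (hc : Continuous c) (hpos : ∀ x ∈ K, 0 < a x) (k : ℕ) :
    ∃ s : ℝ, 0 ≤ s ∧ ∀ x ∈ K, 0 < s ^ (k + 2) * a x + s * b x + c x := by
  obtain ⟨x₀, hx₀, hmin⟩ := hK.exists_isMinOn hne ha.continuousOn
  obtain ⟨β, hβ⟩ := hK.exists_bound_of_continuousOn hb.continuousOn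
  obtain ⟨γ, hγ⟩ := hK.exists_bound_of_continuousOn hc.continuousOn
  have hα := hpos x₀ hx₀
  have hβ0 : 0 ≤ β := (norm_nonneg _).trans (hβ x₀ hx₀)
  have hγ0 : 0 ≤ γ := (norm_nonneg _).trans (hγ x₀ hx₀)
  obtain ⟨s, hs1, hs⟩ : ∃ s : ℝ, 1 ≤ s ∧ β + γ < s * a x₀ := by
    refine ⟨(β + γ) / a x₀ + 1, le_add_of_nonneg_left (by positivity), ?_⟩
    rw [add_mul, div_mul_cancel₀ _ hα.ne']
    linarith
  refine ⟨s, by linarith, fun x hx => ?_⟩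
  have h₁ : s ^ 2 * a x₀ ≤ s ^ (k + 2) * a x :=
    mul_le_mul (pow_le_pow_right₀ hs1 (by lia)) (hmin hx) hα.le (by positivity)
  have h₂ := neg_le_of_abs_le (hβ x hx)
  have h₃ := neg_le_of_abs_le (hγ x hx)
  nlinarith [mul_le_mul_of_nonneg_left h₂ (by linarith : 0 ≤ s)]

/-- If `a` is positive on a compact set `K` and `c` takes a nonpositive value there, then the
minimum of `s ^ (k + 2) * a + s * b + c` over `K` vanishes for some `s`. -/
theorem exists_isMinOn_pow_mul_add_eq_zero {X : Type*} [TopologicalSpace X] {K : Set X}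
    (hK : IsCompact K) {a b c : X → ℝ} (ha : Continuous a) (hb : Continuous b)
    (hc : Continuous c) (hpos : ∀ x ∈ K, 0 < a x) (hc0 : ∃ x ∈ K, c x ≤ 0) (k : ℕ) :
    ∃ s : ℝ, ∃ x ∈ K, s ^ (k + 2) * a x + s * b x + c x = 0 ∧
      ∀ y ∈ K, 0 ≤ s ^ (k + 2) * a y + s * b y + c y := by
  obtain ⟨x₀, hx₀, hcx₀⟩ := hc0
  obtain ⟨M, hM0, hM⟩ := exists_forall_pow_mul_add_pos hK ⟨x₀, hx₀⟩ ha hb hc hpos k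
  set f : ℝ × X → ℝ := fun p => p.1 ^ (k + 2) * a p.2 + p.1 * b p.2 + c p.2 with hf
  have hfc : Continuous f := by fun_prop
  have hS : IsCompact ((Set.Icc 0 M ×ˢ K) ∩ f ⁻¹' Set.Iic 0) :=
    (isCompact_Icc.prod hK).inter_right (isClosed_Iic.preimage hfc)
  obtain ⟨⟨s, x⟩, ⟨⟨hs, hxK⟩, hsx⟩, hmax⟩ := hS.exists_isMaxOn
    ⟨(0, x₀), ⟨⟨⟨le_rfl, hM0⟩, hx₀⟩, by simpa [hf] using hcx₀⟩⟩ continuous_fst.continuousOn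
  have hsM : s < M := by
    refine lt_of_le_of_ne hs.2 fun h => ?_
    subst h
    exact (hM x hxK).not_ge hsx
  have hmin (y : X) (hy : y ∈ K) : 0 ≤ f (s, y) := by
    by_contra! hneg
    have hcont : Continuous fun t : ℝ => f (t, y) := by fun_prop
    obtain ⟨t, ht, htM⟩ := (((hcont.continuousAt.tendsto.eventually_lt_const hneg).filter_mono
      nhdsWithin_le_nhds).and (Ioo_mem_nhdsGT hsM)).exists
    have hts : t ≤ s := @hmax (t, y)
      ⟨⟨⟨hs.1.trans htM.1.le, htM.2.le⟩, hy⟩, ht.le⟩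
    exact hts.not_gt htM.1
  exact ⟨s, x, hxK, le_antisymm hsx (hmin x hxK), hmin⟩

/-- If `𝒜, ℬ` are symmetric and `𝒜` strictly copositive, then `(𝒜, ℬ, −ℐ)` has at least one
`m`-degree Pareto-eigenpair, `m = k + 2`. -/
theorem symmetric_existence (k n : ℕ) (hn : 1 ≤ n)
    (A B : (Fin (k + 2) → Fin n) → ℝ) (hA : IsSymm' A) (hB : IsSymm' B)
    (hscop : ∀ x : Fin n → ℝ, (∀ i, 0 ≤ x i) → x ≠ 0 → 0 < tEval A x) :
    ∃ (lam : ℝ) (x : Fin n → ℝ), IsParetoPair A B (fun f => -unitT f) lam x := by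
  have hne (x : Fin n → ℝ) (hx : x ∈ stdSimplex ℝ (Fin n)) : x ≠ 0 := by
    rintro rfl
    simpa using hx.2
  have he : Pi.single ⟨0, hn⟩ 1 ∈ stdSimplex ℝ (Fin n) := single_mem_stdSimplex ℝ _
  obtain ⟨lam, x, hx, hx0, hmin⟩ := exists_isMinOn_pow_mul_add_eq_zero
    (isCompact_stdSimplex ℝ (Fin n)) (continuous_tEval A) (continuous_tEval B)
    (continuous_tEval fun f => -unitT f) (fun x hx => hscop x hx.1 (hne x hx))
    ⟨_, he, tEval_neg_unitT_nonpos he.1⟩ k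
  rw [← tEval_triple] at hx0
  simp only [← tEval_triple] at hmin
  have hsymm := isSymm'_triple hA hB isSymm'_neg_unitT lam
  refine ⟨lam, x, hne x hx, hx.1, fun i => ?_, (sum_mul_tApply _ x).trans hx0⟩
  exact tApply_nonneg_of_tEval_nonneg hsymm
    (fun y hy => tEval_nonneg_of_forall_stdSimplex hmin hy) hx.1 hx0 i
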